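/- Let A be a core regular double Stone algebra with core element k. Then A is generated by C(A) ∪ {k} under ∨ and ∧: every element of A lies in the smallest subset of A that contains C(A) ∪ {k} and is closed under the binary operations ∨ and ∧. -/

import Mathlib

class DoubleStoneAlgebra (α : Type*) extends DistribLattice α, BoundedOrder α where
  pstar : α → α
  pplus : α → α
  pstar_spec : ∀ x y : α, y ⊓ x = ⊥ ↔ y ≤ pstar x
  pplus_spec : ∀ x y : α, y ⊔ x = ⊤ ↔ pplus x ≤ y
  stone : ∀ x : α, pstar x ⊔ pstar (pstar x) = ⊤
  stone_dual : ∀ x : α, pplus x ⊓ pplus (pplus x) = ⊥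

class CRDSA (α : Type*) extends DoubleStoneAlgebra α where
  regular : ∀ x y : α, pstar x = pstar y → pplus x = pplus y → x = y
  core_nonempty : ∃ k : α, pstar k = ⊥ ∧ pplus k = ⊤

open DoubleStoneAlgebra

/-- The center of a (core) regular double Stone algebra: `C(A) = {a : a* = a⁺}`. -/
def center (A : Type*) [CRDSA A] : Set A := {a : A | pstar a = pplus a}

theorem CRDSA_compl_mem_center (A : Type*) [CRDSA A] (c d : A)
    (h1 : c ⊓ d = ⊥) (h2 : c ⊔ d = ⊤) : c ∈ center A := by
  have e1 : pstar c = d := by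
    apply le_antisymm
    · have h : pstar c ⊓ c = ⊥ := (pstar_spec c _).2 le_rfl
      calc pstar c = pstar c ⊓ (c ⊔ d) := by rw [h2, inf_top_eq]
        _ = pstar c ⊓ d := by rw [inf_sup_left, h, bot_sup_eq]
        _ ≤ d := inf_le_right
    · exact (pstar_spec c d).1 (by rw [inf_comm, h1])
  have e2 : pplus c = d := by
    apply le_antisymm
    · exact (pplus_spec c d).1 (by rw [sup_comm, h2])
    · have h : pplus c ⊔ c = ⊤ := (pplus_spec c _).2 le_rfl
      calc d ≤ pplus c ⊔ d := le_sup_right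
        _ = pplus c ⊔ (c ⊓ d) := by rw [sup_inf_left, h, top_inf_eq]
        _ = pplus c := by rw [h1, sup_bot_eq]
  show pstar c = pplus c
  rw [e1, e2]

/-- a core regular double Stone algebra `A` with core element `k` is
generated by `C(A) ∪ {k}` under `⊔` and `⊓`: every element of `A` lies in every
subset of `A` containing `C(A) ∪ {k}` that is closed under the binary operations
`⊔` and `⊓` — i.e. in the smallest such subset. -/
theorem CRDSA_generated_by_center_and_core (A : Type*) [CRDSA A]
    (k : A) (hk : pstar k = ⊥ ∧ pplus k = ⊤) (a : A) :
    a ∈ ⋂₀ {T : Set A | center A ∪ {k} ⊆ T ∧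
      ∀ x ∈ T, ∀ y ∈ T, x ⊔ y ∈ T ∧ x ⊓ y ∈ T} := by
  rintro T ⟨hT, hcl⟩
  have s1 : pstar a ⊓ a = ⊥ := (pstar_spec a _).2 le_rfl
  have s2 : pstar (pstar a) ⊓ pstar a = ⊥ := (pstar_spec _ _).2 le_rfl
  have p1 : pplus a ⊔ a = ⊤ := (pplus_spec a _).2 le_rfl
  have p2 : pplus (pplus a) ⊔ pplus a = ⊤ := (pplus_spec _ _).2 le_rfl
  have haq : a ≤ pstar (pstar a) := (pstar_spec _ _).1 (by rw [inf_comm, s1])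
  have hpa : pplus (pplus a) ≤ a := (pplus_spec _ _).1 (by rw [sup_comm, p1])
  have hq : pstar (pstar a) ∈ center A :=
    CRDSA_compl_mem_center A _ (pstar a) s2 (by rw [sup_comm, stone])
  have hp : pplus (pplus a) ∈ center A :=
    CRDSA_compl_mem_center A _ (pplus a) (by rw [inf_comm, stone_dual]) p2
  generalize pstar (pstar a) = q at *
  generalize pplus (pplus a) = p at *
  have key : a = p ⊔ (k ⊓ q) := by
    apply CRDSA.regular
    · have h : ∀ y, y ≤ pstar a ↔ y ≤ pstar (p ⊔ (k ⊓ q)) := by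
        intro y
        rw [← pstar_spec (p ⊔ (k ⊓ q)) y]
        constructor
        · intro hy
          have hx : p ⊔ (k ⊓ q) ≤ q := sup_le (hpa.trans haq) inf_le_right
          rw [eq_bot_iff, ← s2, inf_comm]
          exact inf_le_inf hx hy
        · intro hy
          have h3 : (y ⊓ q) ⊓ k = ⊥ := by
            rw [eq_bot_iff, ← hy]
            exact le_inf (inf_le_left.trans inf_le_left)
              (le_sup_of_le_right (le_inf inf_le_right (inf_le_left.trans inf_le_right)))
          have h4 := (pstar_spec k _).1 h3
          rw [hk.1] at h4
          exact (pstar_spec a y).1 (eq_bot_iff.2 ((inf_le_inf_left y haq).trans h4))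
      exact le_antisymm ((h _).1 le_rfl) ((h _).2 le_rfl)
    · have h : ∀ y, pplus a ≤ y ↔ pplus (p ⊔ (k ⊓ q)) ≤ y := by
        intro y
        rw [← pplus_spec (p ⊔ (k ⊓ q)) y]
        constructor
        · intro hy
          rw [eq_top_iff, ← p2]
          exact sup_le (le_sup_of_le_right le_sup_left) (le_sup_of_le_left hy)
        · intro hy
          have h3 : (y ⊔ p) ⊔ k = ⊤ := by
            rw [eq_top_iff, ← hy, ← sup_assoc]
            exact sup_le_sup_left inf_le_left _
          have h4 := (pplus_spec k _).1 h3
          rw [hk.2] at h4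
          exact (pplus_spec a y).1 (eq_top_iff.2 (h4.trans (sup_le_sup_left hpa y)))
      exact le_antisymm ((h _).2 le_rfl) ((h _).1 le_rfl)
  rw [key]
  exact (hcl _ (hT (Or.inl hp)) _ (hcl _ (hT (Or.inr rfl)) _ (hT (Or.inl hq))).2).1
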